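/- Criterion for the existence of spurious local minima: suppose ᾱ ∈ D and there exist an open set U ⊆ ℝ^m with ᾱ ∈ U ⊆ D and a linear subspace V of Y with V ≠ Y such that F(U) ⊆ V. Then for every v in the orthogonal complement of V with ‖v‖ = 1 and every s ∈ ℝ with |s| > (Θ/(1 − Θ))^{1/2}·‖F(ᾱ)‖, setting y^s := F(ᾱ) + s·v, the point ᾱ is a local minimizer but not a global minimizer of L_{y^s} (a spurious local minimum), and the quadratic growth condition L_{y^s}(α) − L_{y^s}(ᾱ) ≥ ‖F(α) − F(ᾱ)‖² holds for all α ∈ U. -/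

import Mathlib

open Filter Metric
open scoped InnerProductSpace

noncomputable section

/-- The optimal value of the squared loss `inf_{α ∈ D} ‖F α - y‖²`. -/
def lossInf {Y : Type} [NormedAddCommGroup Y] {m : ℕ}
    (D : Set (Fin m → ℝ)) (F : (Fin m → ℝ) → Y) (y : Y) : ℝ :=
  sInf ((fun α => ‖F α - y‖ ^ 2) '' D)

/-- The worst-case error bound `Θ = sup_{‖y‖ = 1} inf_{α ∈ D} ‖F α - y‖²`. -/
def Theta {Y : Type} [NormedAddCommGroup Y] {m : ℕ}
    (D : Set (Fin m → ℝ)) (F : (Fin m → ℝ) → Y) : ℝ :=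
  sSup ((fun y => lossInf D F y) '' {y : Y | ‖y‖ = 1})

/-- The set of best approximations of `y` in `closure (F '' D)`. -/
def bestApprox {Y : Type} [NormedAddCommGroup Y] {m : ℕ}
    (D : Set (Fin m → ℝ)) (F : (Fin m → ℝ) → Y) (y : Y) : Set Y :=
  {z | z ∈ closure (F '' D) ∧ ‖z - y‖ = Metric.infDist y (closure (F '' D))}

theorem lossInf_le {Y : Type} [NormedAddCommGroup Y] {m : ℕ}
    {D : Set (Fin m → ℝ)} (F : (Fin m → ℝ) → Y) (y : Y) {α : Fin m → ℝ} (hα : α ∈ D) :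
    lossInf D F y ≤ ‖F α - y‖ ^ 2 :=
  csInf_le ⟨0, by rintro _ ⟨β, -, rfl⟩; positivity⟩ ⟨α, hα, rfl⟩

theorem le_lossInf {Y : Type} [NormedAddCommGroup Y] {m : ℕ}
    {D : Set (Fin m → ℝ)} (hD : D.Nonempty) {F : (Fin m → ℝ) → Y} {y : Y} {c : ℝ}
    (h : ∀ α ∈ D, c ≤ ‖F α - y‖ ^ 2) : c ≤ lossInf D F y :=
  le_csInf (hD.image _) (by rintro _ ⟨α, hα, rfl⟩; exact h α hα)

theorem lossInf_eq_infDist_sq {Y : Type} [NormedAddCommGroup Y] {m : ℕ}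
    {D : Set (Fin m → ℝ)} (hD : D.Nonempty) (F : (Fin m → ℝ) → Y) (y : Y) :
    lossInf D F y = infDist y (F '' D) ^ 2 := by
  apply le_antisymm
  · refine (Real.sqrt_le_left infDist_nonneg).1 ((le_infDist (hD.image F)).2 ?_)
    rintro _ ⟨α, hα, rfl⟩
    rw [dist_comm, dist_eq_norm]
    exact Real.sqrt_le_iff.2 ⟨norm_nonneg _, lossInf_le F y hα⟩
  · refine le_lossInf hD fun α hα => ?_
    rw [← dist_eq_norm, dist_comm]
    exact pow_le_pow_left₀ infDist_nonneg (infDist_le_dist_of_mem (Set.mem_image_of_mem F hα)) 2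

theorem continuous_lossInf {Y : Type} [NormedAddCommGroup Y] {m : ℕ}
    {D : Set (Fin m → ℝ)} (hD : D.Nonempty) (F : (Fin m → ℝ) → Y) :
    Continuous (lossInf D F) := by
  rw [funext (lossInf_eq_infDist_sq hD F)]
  exact (continuous_infDist_pt _).pow 2

theorem isCompact_lossInf_image_sphere {Y : Type} [NormedAddCommGroup Y]
    [InnerProductSpace ℝ Y] [FiniteDimensional ℝ Y] {m : ℕ}
    {D : Set (Fin m → ℝ)} (hD : D.Nonempty) (F : (Fin m → ℝ) → Y) :
    IsCompact ((fun y => lossInf D F y) '' {y : Y | ‖y‖ = 1}) := by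
  have hs : {y : Y | ‖y‖ = 1} = sphere 0 1 := by ext; simp
  rw [hs]
  have := FiniteDimensional.proper ℝ Y
  exact (isCompact_sphere _ _).image (continuous_lossInf hD F)

theorem Theta_lt_one {Y : Type} [NormedAddCommGroup Y]
    [InnerProductSpace ℝ Y] [FiniteDimensional ℝ Y] [Nontrivial Y] {m : ℕ}
    {D : Set (Fin m → ℝ)} (hD : D.Nonempty) {F : (Fin m → ℝ) → Y}
    (hexpr : ∀ y : Y, y ≠ 0 → lossInf D F y < ‖y‖ ^ 2) : Theta D F < 1 := by
  obtain ⟨u, hu⟩ := exists_norm_eq Y (zero_le_one' ℝ)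
  obtain ⟨y, hy, hyΘ⟩ := (isCompact_lossInf_image_sphere hD F).sSup_mem ⟨_, u, hu, rfl⟩
  have hy1 : ‖y‖ = 1 := hy
  have hy0 : y ≠ 0 := norm_ne_zero_iff.1 (by simp [hy1])
  calc Theta D F = lossInf D F y := hyΘ.symm
    _ < ‖y‖ ^ 2 := hexpr y hy0
    _ = 1 := by simp [hy1]

theorem lossInf_smul_le {Y : Type} [NormedAddCommGroup Y] [InnerProductSpace ℝ Y] {m : ℕ}
    {D : Set (Fin m → ℝ)} (hD : D.Nonempty) {F : (Fin m → ℝ) → Y}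
    (hcone : ∀ y ∈ F '' D, ∀ s : ℝ, 0 < s → s • y ∈ F '' D) {t : ℝ} (ht : 0 < t) (y : Y) :
    lossInf D F (t • y) ≤ t ^ 2 * lossInf D F y := by
  rw [← div_le_iff₀' (by positivity)]
  refine le_lossInf hD fun α hα => ?_
  obtain ⟨β, hβ, hβα⟩ := hcone _ ⟨α, hα, rfl⟩ t ht
  rw [div_le_iff₀' (by positivity)]
  calc lossInf D F (t • y) ≤ ‖F β - t • y‖ ^ 2 := lossInf_le F _ hβ
    _ = t ^ 2 * ‖F α - y‖ ^ 2 := by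
      rw [hβα, ← smul_sub, norm_smul, mul_pow, Real.norm_eq_abs, sq_abs]

theorem lossInf_le_Theta_mul {Y : Type} [NormedAddCommGroup Y]
    [InnerProductSpace ℝ Y] [FiniteDimensional ℝ Y] {m : ℕ}
    {D : Set (Fin m → ℝ)} (hD : D.Nonempty) {F : (Fin m → ℝ) → Y}
    (hcone : ∀ y ∈ F '' D, ∀ s : ℝ, 0 < s → s • y ∈ F '' D) {y : Y} (hy : y ≠ 0) :
    lossInf D F y ≤ Theta D F * ‖y‖ ^ 2 := by
  have hpos : 0 < ‖y‖ := norm_pos_iff.2 hy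
  have hunit : lossInf D F (‖y‖⁻¹ • y) ≤ Theta D F :=
    le_csSup (isCompact_lossInf_image_sphere hD F).bddAbove
      ⟨_, by simp [norm_smul, hpos.ne'], rfl⟩
  calc lossInf D F y = lossInf D F (‖y‖ • ‖y‖⁻¹ • y) := by
        rw [smul_inv_smul₀ hpos.ne']
    _ ≤ ‖y‖ ^ 2 * lossInf D F (‖y‖⁻¹ • y) := lossInf_smul_le hD hcone hpos _
    _ ≤ Theta D F * ‖y‖ ^ 2 := by
      rw [mul_comm]; gcongr

theorem spurious_local_minima_criterion {Y : Type} [NormedAddCommGroup Y]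
    [InnerProductSpace ℝ Y] [FiniteDimensional ℝ Y] [Nontrivial Y] {m : ℕ}
    (D : Set (Fin m → ℝ)) (hD : D.Nonempty) (F : (Fin m → ℝ) → Y)
    (hcone : ∀ y ∈ F '' D, ∀ s : ℝ, 0 < s → s • y ∈ F '' D)
    (hexpr : ∀ y : Y, y ≠ 0 → lossInf D F y < ‖y‖ ^ 2)
    (abar : Fin m → ℝ) (habar : abar ∈ D)
    (U : Set (Fin m → ℝ)) (hU : IsOpen U) (haU : abar ∈ U) (hUD : U ⊆ D)
    (V : Submodule ℝ Y) (hV : V ≠ ⊤) (hFU : F '' U ⊆ V) :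
    ∀ v ∈ Vᗮ, ‖v‖ = 1 →
      ∀ s : ℝ, Real.sqrt (Theta D F / (1 - Theta D F)) * ‖F abar‖ < |s| →
        IsLocalMinOn (fun α => ‖F α - (F abar + s • v)‖ ^ 2) D abar ∧
        ¬ IsMinOn (fun α => ‖F α - (F abar + s • v)‖ ^ 2) D abar ∧
        ∀ α ∈ U, ‖F α - F abar‖ ^ 2 ≤
          ‖F α - (F abar + s • v)‖ ^ 2 - ‖F abar - (F abar + s • v)‖ ^ 2 := by
  intro v hv hv1 s hs
  have horth : ∀ w ∈ V, ‖w + s • v‖ ^ 2 = ‖w‖ ^ 2 + s ^ 2 := fun w hw => by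
    rw [norm_add_sq_real, inner_smul_right, V.mem_orthogonal v |>.1 hv w hw, norm_smul, hv1,
      Real.norm_eq_abs, mul_one, sq_abs]
    ring
  have habarV : F abar ∈ V := hFU ⟨abar, haU, rfl⟩
  have hloss : ‖F abar - (F abar + s • v)‖ ^ 2 = s ^ 2 := by
    simp [norm_smul, hv1]
  have hgrowth : ∀ α ∈ U, ‖F α - F abar‖ ^ 2 ≤
      ‖F α - (F abar + s • v)‖ ^ 2 - ‖F abar - (F abar + s • v)‖ ^ 2 := fun α hα => by
    have h := horth _ (V.sub_mem habarV (hFU ⟨α, hα, rfl⟩))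
    rw [hloss, norm_sub_rev (F α) (F abar), norm_sub_rev (F α),
      show F abar + s • v - F α = F abar - F α + s • v by abel, h]
    linarith
  refine ⟨?_, fun hmin => ?_, hgrowth⟩
  · filter_upwards [mem_nhdsWithin_of_mem_nhds (hU.mem_nhds haU)] with α hα
    linarith [hgrowth α hα, sq_nonneg ‖F α - F abar‖]
  · have hΘ : 0 < 1 - Theta D F := sub_pos.2 (Theta_lt_one hD hexpr)
    have hs0 : 0 < s ^ 2 := by
      rw [← sq_abs]
      have : 0 < |s| := lt_of_le_of_lt (by positivity) hs
      positivity
    have hnorm := horth _ habarV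
    have hne : F abar + s • v ≠ 0 := fun h => by
      rw [h, norm_zero] at hnorm
      nlinarith [sq_nonneg ‖F abar‖]
    have hupper := lossInf_le_Theta_mul hD hcone hne
    have hlower : s ^ 2 ≤ lossInf D F (F abar + s • v) :=
      le_lossInf hD fun α hα => hloss ▸ hmin hα
    have hbound : Theta D F / (1 - Theta D F) * ‖F abar‖ ^ 2 < s ^ 2 := by
      calc Theta D F / (1 - Theta D F) * ‖F abar‖ ^ 2
          ≤ Real.sqrt (Theta D F / (1 - Theta D F)) ^ 2 * ‖F abar‖ ^ 2 := by
            gcongr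
            exact (Real.sqrt_le_left (Real.sqrt_nonneg _)).1 le_rfl
        _ < s ^ 2 := by
            rw [← mul_pow, ← sq_abs s]
            gcongr
    rw [div_mul_eq_mul_div, div_lt_iff₀ hΘ] at hbound
    rw [hnorm] at hupper
    linarith
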